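/- Strong consistency of the closed-form estimator for the BAR model with positive correlations (Theorem 3): let θ0 = (A, b, ρ_w) ∈ Θ with c_i = b_i ρ_{w_i}, and let μ be any initial distribution on {0,1}^p. For a trajectory, horizon T, state u ∈ {0,1}^p and r ∈ [p], let N_u(T) = #{0 ≤ k ≤ T−1 : X(k) = u}, let N_{u,r,1}(T) = #{0 ≤ k ≤ T−1 : X(k) = u, X_r(k+1) = 1}, and let V_T ⊆ {0,1}^p be the set of states visited by time T−1. Define ĉ_i(T) = N_{0_p,i,1}(T)/N_{0_p}(T) (when N_{0_p}(T) ≥ 1) and, when the matrix ∑_{u∈V_T} u u^⊤ is invertible, define â_r(T) = (∑_{u∈V_T} u u^⊤)^{−1} ∑_{u∈V_T} u (N_{u,r,1}(T)/N_u(T) − ĉ_r(T)) for r ∈ [p]. Then almost surely under P_{θ0,μ}: these estimators are well-defined for all sufficiently large T, ĉ(T) → c, and â_r(T) → a_r for every r ∈ [p] as T → ∞ (where a_r^⊤ is the r-th row of A). -/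

import Mathlib

open MeasureTheory Filter Matrix

/-- The state space `{0,1}^p` of the BAR model, encoded as Boolean vectors. -/
abbrev State (p : ℕ) := Fin p → Bool

/-- The real vector in `{0,1}^p ⊆ ℝ^p` corresponding to a state. -/
noncomputable def stR {p : ℕ} (u : State p) : Fin p → ℝ := fun i => if u i then 1 else 0

/-- A parameter tuple `θ = (A, b, ρ_w)` of the BAR model with positive correlations. -/
abbrev Param (p : ℕ) := Matrix (Fin p) (Fin p) ℝ × (Fin p → ℝ) × (Fin p → ℝ)

/-- The parameter space `Θ` of the BAR model with positive correlations. -/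
def barSpace (p : ℕ) (bmin ρmin ρmax : ℝ) : Set (Param p) :=
  {θ | (∀ i j, 0 ≤ θ.1 i j) ∧ (∀ i, (∑ j, θ.1 i j) + θ.2.1 i = 1) ∧
       (∀ i, bmin ≤ θ.2.1 i) ∧ (∀ i, θ.2.2 i ∈ Set.Icc ρmin ρmax)}

/-- The Bernoulli parameter `a_i^⊤ u + b_i ρ_{w_i}` of node `i` given previous state `u`. -/
noncomputable def bern {p : ℕ} (θ : Param p) (u : State p) (i : Fin p) : ℝ :=
  (∑ j, θ.1 i j * stR u j) + θ.2.1 i * θ.2.2 i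

/-- The BAR transition probability `p_{uv}(θ)`. -/
noncomputable def barTrans {p : ℕ} (θ : Param p) (u v : State p) : ℝ :=
  ∏ i, if v i then bern θ u i else 1 - bern θ u i

/-- The log-likelihood `∑_{k=0}^{T-1} log p_{X(k)X(k+1)}(θ)` of a trajectory prefix. -/
noncomputable def logLik {p : ℕ} (θ : Param p) (T : ℕ) (ω : ℕ → State p) : ℝ :=
  ∑ k ∈ Finset.range T, Real.log (barTrans θ (ω k) (ω (k + 1)))

/-- `P` is the law of the BAR Markov chain with parameter `θ0` and initial distribution `μ`:
its finite-dimensional cylinder probabilities are the Markovian ones. -/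
def IsBARLaw {p : ℕ} (θ0 : Param p) (μ : State p → ℝ)
    (P : Measure (ℕ → State p)) : Prop :=
  ∀ (n : ℕ) (x : ℕ → State p),
    P {ω | ∀ k ≤ n, ω k = x k} =
      ENNReal.ofReal (μ (x 0) * ∏ k ∈ Finset.range n, barTrans θ0 (x k) (x (k + 1)))

/-- `N_u(T)`: the number of times `0 ≤ k ≤ T-1` with `X(k) = u`. -/
def Ncnt {p : ℕ} (u : State p) (T : ℕ) (ω : ℕ → State p) : ℕ :=
  ((Finset.range T).filter fun k => ω k = u).card

/-- `N_{uv}(T)`: the number of one-step transitions from `u` to `v` up to time `T`. -/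
def Ntrans {p : ℕ} (u v : State p) (T : ℕ) (ω : ℕ → State p) : ℕ :=
  ((Finset.range T).filter fun k => ω k = u ∧ ω (k + 1) = v).card

/-- `N_{u,r,1}(T)`: the number of `0 ≤ k ≤ T-1` with `X(k) = u` and `X_r(k+1) = 1`. -/
def Nr1 {p : ℕ} (u : State p) (r : Fin p) (T : ℕ) (ω : ℕ → State p) : ℕ :=
  ((Finset.range T).filter fun k => ω k = u ∧ ω (k + 1) r = true).card

/-- The set of states visited by time `T - 1`. -/
def visited {p : ℕ} (T : ℕ) (ω : ℕ → State p) : Finset (State p) :=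
  (Finset.range T).image ω

/-- The Gram matrix `∑_{u ∈ V_T} u u^⊤` of the visited states. -/
noncomputable def gram {p : ℕ} (T : ℕ) (ω : ℕ → State p) : Matrix (Fin p) (Fin p) ℝ :=
  ∑ u ∈ visited T ω, vecMulVec (stR u) (stR u)

/-- The closed-form estimator `ĉ_i(T) = N_{0_p,i,1}(T) / N_{0_p}(T)` of `c_i = b_i ρ_{w_i}`. -/
noncomputable def chat {p : ℕ} (i : Fin p) (T : ℕ) (ω : ℕ → State p) : ℝ :=
  (Nr1 (fun _ => false) i T ω : ℝ) / (Ncnt (fun _ => false) T ω : ℝ)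

/-- The closed-form estimator
`â_r(T) = (∑_{u∈V_T} u u^⊤)⁻¹ ∑_{u∈V_T} u (N_{u,r,1}(T)/N_u(T) − ĉ_r(T))` of row `r` of `A`. -/
noncomputable def ahat {p : ℕ} (r : Fin p) (T : ℕ) (ω : ℕ → State p) : Fin p → ℝ :=
  (gram T ω)⁻¹ *ᵥ
    ∑ u ∈ visited T ω, (((Nr1 u r T ω : ℝ) / (Ncnt u T ω : ℝ)) - chat r T ω) • stR u

/-- Strong law of large numbers for uniformly bounded increments, each of which is orthogonal to
the sum of the preceding ones. -/
theorem ae_tendsto_sum_div_of_bounded_of_orthogonal {Ω : Type*} [MeasurableSpace Ω]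
    (P : Measure Ω) [IsProbabilityMeasure P] (D : ℕ → Ω → ℝ) (C : ℝ)
    (hmeas : ∀ k, Measurable (D k)) (hbdd : ∀ k ω, |D k ω| ≤ C)
    (horth : ∀ n, ∫ ω, (∑ k ∈ Finset.range n, D k ω) * D n ω ∂P = 0) :
    ∀ᵐ ω ∂P, Tendsto (fun n : ℕ => (∑ k ∈ Finset.range n, D k ω) / n) atTop (nhds 0) := by
  have hSmeas : ∀ n, Measurable fun ω => ∑ k ∈ Finset.range n, D k ω := fun n =>
    Finset.measurable_sum _ fun k _ => hmeas k
  have hSbdd : ∀ n ω, |∑ k ∈ Finset.range n, D k ω| ≤ n * C := fun n ω => by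
    refine (Finset.abs_sum_le_sum_abs _ _).trans ?_
    refine (Finset.sum_le_sum fun k _ => hbdd k ω).trans ?_
    simp
  have hint : ∀ (f : Ω → ℝ) (K : ℝ), Measurable f → (∀ ω, |f ω| ≤ K) → Integrable f P :=
    fun f K hf hK => Integrable.of_bound hf.aestronglyMeasurable K
      (Eventually.of_forall fun ω => by simpa using hK ω)
  have hSq : ∀ n, Integrable (fun ω => (∑ k ∈ Finset.range n, D k ω) ^ 2) P := fun n =>
    hint _ ((n * C) ^ 2) ((hSmeas n).pow_const 2) fun ω => by
      rw [abs_pow]; exact pow_le_pow_left₀ (abs_nonneg _) (hSbdd n ω) 2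
  have hDsq : ∀ n, Integrable (fun ω => (D n ω) ^ 2) P := fun n =>
    hint _ (C ^ 2) ((hmeas n).pow_const 2) fun ω => by
      rw [abs_pow]; exact pow_le_pow_left₀ (abs_nonneg _) (hbdd n ω) 2
  have hcross : ∀ n, Integrable (fun ω => (∑ k ∈ Finset.range n, D k ω) * D n ω) P := fun n =>
    hint _ ((n * C) * C) ((hSmeas n).mul (hmeas n)) fun ω => by
      rw [abs_mul]
      exact mul_le_mul (hSbdd n ω) (hbdd n ω) (abs_nonneg _) ((abs_nonneg _).trans (hSbdd n ω))
  have hsecond : ∀ n : ℕ, ∫ ω, (∑ k ∈ Finset.range n, D k ω) ^ 2 ∂P ≤ n * C ^ 2 := by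
    intro n
    induction n with
    | zero => simp
    | succ n ih =>
      have hexp : (fun ω => (∑ k ∈ Finset.range (n + 1), D k ω) ^ 2) = fun ω =>
          ((∑ k ∈ Finset.range n, D k ω) ^ 2 + 2 * ((∑ k ∈ Finset.range n, D k ω) * D n ω))
            + (D n ω) ^ 2 := by
        funext ω
        rw [Finset.sum_range_succ]
        ring
      have hadd : Integrable (fun ω => (∑ k ∈ Finset.range n, D k ω) ^ 2 +
          2 * ((∑ k ∈ Finset.range n, D k ω) * D n ω)) P := (hSq n).add ((hcross n).const_mul 2)
      have hle : ∫ ω, (D n ω) ^ 2 ∂P ≤ C ^ 2 := by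
        have := integral_mono (hDsq n) (integrable_const (C ^ 2)) fun ω => by
          simpa using pow_le_pow_left₀ (abs_nonneg _) (hbdd n ω) 2
        simpa using this
      rw [hexp, integral_add hadd (hDsq n),
        integral_add (hSq n) ((hcross n).const_mul 2), integral_const_mul, horth n]
      push_cast
      linarith
  have hsquares : ∀ᵐ ω ∂P, Tendsto
      (fun m : ℕ => ((∑ k ∈ Finset.range (m * m), D k ω) / ((m * m : ℕ) : ℝ)) ^ 2)
      atTop (nhds 0) := by
    have hfin : ∫⁻ ω, ∑' m : ℕ, ENNReal.ofReal
        (((∑ k ∈ Finset.range (m * m), D k ω) / ((m * m : ℕ) : ℝ)) ^ 2) ∂P ≠ ⊤ := by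
      rw [lintegral_tsum fun m =>
        (((hSmeas (m * m)).div_const _).pow_const 2).ennreal_ofReal.aemeasurable]
      have hsum : Summable fun m : ℕ => C ^ 2 * (1 / (m : ℝ) ^ 2) :=
        (Real.summable_one_div_nat_pow.mpr one_lt_two).mul_left _
      refine ne_top_of_le_ne_top hsum.tsum_ofReal_ne_top (ENNReal.tsum_le_tsum fun m => ?_)
      have hi : Integrable
          (fun ω => ((∑ k ∈ Finset.range (m * m), D k ω) / ((m * m : ℕ) : ℝ)) ^ 2) P := by
        simp_rw [div_pow]
        exact (hSq _).div_const _
      rw [← ofReal_integral_eq_lintegral_ofReal hi (Eventually.of_forall fun ω => sq_nonneg _)]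
      refine ENNReal.ofReal_le_ofReal ?_
      simp_rw [div_pow]
      rw [integral_div]
      rcases Nat.eq_zero_or_pos m with rfl | hm
      · simp
      · have hm' : (0 : ℝ) < m := by exact_mod_cast hm
        rw [div_le_iff₀ (by positivity)]
        refine (hsecond _).trans (le_of_eq ?_)
        push_cast
        field_simp
    filter_upwards [ae_lt_top' (AEMeasurable.tsum fun m =>
      (((hSmeas (m * m)).div_const _).pow_const 2).ennreal_ofReal.aemeasurable) hfin] with ω hω
    have h0 := ENNReal.tendsto_atTop_zero_of_tsum_ne_top hω.ne
    have h1 := (ENNReal.tendsto_toReal ENNReal.zero_ne_top).comp h0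
    refine h1.congr fun m => ?_
    simp only [Function.comp]
    exact ENNReal.toReal_ofReal (sq_nonneg _)
  filter_upwards [hsquares] with ω hω
  have habs : Tendsto (fun m : ℕ => |(∑ k ∈ Finset.range (m * m), D k ω) / ((m * m : ℕ) : ℝ)|)
      atTop (nhds 0) := by
    have := (Real.continuous_sqrt.tendsto 0).comp hω
    rw [Real.sqrt_zero] at this
    exact this.congr fun m => Real.sqrt_sq_eq_abs _
  have hgap : Tendsto (fun m : ℕ => 2 * C / (m : ℝ)) atTop (nhds 0) :=
    tendsto_const_div_atTop_nhds_zero_nat _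
  have hsqrt : Tendsto Nat.sqrt atTop atTop :=
    tendsto_atTop_atTop.mpr fun b => ⟨b * b, fun a ha => Nat.le_sqrt.mpr ha⟩
  have hlim := (habs.add hgap).comp hsqrt
  rw [add_zero] at hlim
  refine squeeze_zero_norm' ?_ hlim
  filter_upwards [eventually_ge_atTop 1] with n hn
  simp only [Function.comp, Real.norm_eq_abs]
  have hC : 0 ≤ C := (abs_nonneg _).trans (hbdd 0 ω)
  set m := Nat.sqrt n with hmdef
  have hm1 : 1 ≤ m := Nat.le_sqrt.mpr (by simpa using hn)
  have hmn : m * m ≤ n := Nat.sqrt_le n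
  have hnm : n ≤ m * m + m + m := Nat.sqrt_le_add n
  have hm0 : (0 : ℝ) < m := by exact_mod_cast hm1
  have hmnR : (m : ℝ) * m ≤ n := by exact_mod_cast hmn
  have hnmR : (n : ℝ) ≤ m * m + m + m := by exact_mod_cast hnm
  have hn0 : (0 : ℝ) < n := by exact_mod_cast hn
  have hdiff : |∑ k ∈ Finset.range n, D k ω| ≤
      |∑ k ∈ Finset.range (m * m), D k ω| + 2 * m * C := by
    rw [← Finset.sum_range_add_sum_Ico _ hmn]
    refine (abs_add_le _ _).trans (add_le_add_right ?_ _)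
    refine (Finset.abs_sum_le_sum_abs _ _).trans ?_
    refine (Finset.sum_le_sum fun k _ => hbdd k ω).trans ?_
    simp only [Finset.sum_const, Nat.card_Ico, nsmul_eq_mul]
    refine mul_le_mul_of_nonneg_right ?_ hC
    rw [Nat.cast_sub hmn]
    push_cast
    linarith
  rw [abs_div, abs_div, Nat.abs_cast, Nat.abs_cast]
  push_cast
  calc |∑ k ∈ Finset.range n, D k ω| / n
      ≤ (|∑ k ∈ Finset.range (m * m), D k ω| + 2 * m * C) / n := by gcongr
    _ ≤ (|∑ k ∈ Finset.range (m * m), D k ω| + 2 * m * C) / (m * m) := by gcongr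
    _ = _ := by field_simp

theorem bern_pos {p : ℕ} {bmin ρmin ρmax : ℝ} (hbmin : 0 < bmin) (hρmin : 0 < ρmin)
    {θ : Param p} (hθ : θ ∈ barSpace p bmin ρmin ρmax) (u : State p) (i : Fin p) :
    0 < bern θ u i := by
  obtain ⟨hA, -, hb, hw⟩ := hθ
  have h1 : 0 ≤ ∑ j, θ.1 i j * stR u j := Finset.sum_nonneg fun j _ =>
    mul_nonneg (hA i j) (by unfold stR; split_ifs <;> norm_num)
  have h2 : 0 < θ.2.1 i * θ.2.2 i := mul_pos (hbmin.trans_le (hb i)) (hρmin.trans_le (hw i).1)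
  unfold bern
  linarith

theorem bern_lt_one {p : ℕ} {bmin ρmin ρmax : ℝ} (hbmin : 0 < bmin) (hρmax : ρmax < 1)
    {θ : Param p} (hθ : θ ∈ barSpace p bmin ρmin ρmax) (u : State p) (i : Fin p) :
    bern θ u i < 1 := by
  obtain ⟨hA, hs, hb, hw⟩ := hθ
  have h1 : ∑ j, θ.1 i j * stR u j ≤ ∑ j, θ.1 i j := Finset.sum_le_sum fun j _ =>
    mul_le_of_le_one_right (hA i j) (by unfold stR; split_ifs <;> norm_num)
  have h2 : θ.2.1 i * θ.2.2 i < θ.2.1 i :=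
    mul_lt_of_lt_one_right (hbmin.trans_le (hb i)) ((hw i).2.trans_lt hρmax)
  have := hs i
  unfold bern
  linarith

theorem barTrans_pos {p : ℕ} {bmin ρmin ρmax : ℝ} (hbmin : 0 < bmin) (hρmin : 0 < ρmin)
    (hρmax : ρmax < 1) {θ : Param p} (hθ : θ ∈ barSpace p bmin ρmin ρmax) (u v : State p) :
    0 < barTrans θ u v := by
  refine Finset.prod_pos fun i _ => ?_
  split_ifs
  · exact bern_pos hbmin hρmin hθ u i
  · exact sub_pos.mpr (bern_lt_one hbmin hρmax hθ u i)

theorem sum_barTrans {p : ℕ} (θ : Param p) (u : State p) : ∑ v, barTrans θ u v = 1 := by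
  have h := Fintype.prod_sum fun (i : Fin p) (x : Bool) =>
    if x then bern θ u i else 1 - bern θ u i
  unfold barTrans
  rw [← h]
  simp

theorem sum_barTrans_mul_indicator {p : ℕ} (θ : Param p) (u : State p) (r : Fin p) :
    ∑ v, barTrans θ u v * (if v r then 1 else 0) = bern θ u r := by
  have h := Fintype.prod_sum fun (i : Fin p) (x : Bool) =>
    (if x then bern θ u i else 1 - bern θ u i) * (if i = r then (if x then 1 else 0) else 1)
  have h' : ∀ v : State p, barTrans θ u v * (if v r then 1 else 0) =
      ∏ i, (if v i then bern θ u i else 1 - bern θ u i) *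
        (if i = r then (if v i then 1 else 0) else 1) := fun v => by
    rw [Finset.prod_mul_distrib, Finset.prod_ite_eq' Finset.univ r]
    simp [barTrans]
  simp_rw [h']
  rw [← h]
  rw [Finset.prod_eq_single r]
  · simp
  · intro i _ hi
    simp [hi]
  · simp

/-- Under the law of the chain, a function of the first `n + 1` states is orthogonal to every
function of the `n`-th transition which has conditional mean zero. -/
theorem integral_mul_transition_eq_zero {p : ℕ} {θ : Param p} {μ : State p → ℝ}
    {P : Measure (ℕ → State p)} [IsProbabilityMeasure P] (hP : IsBARLaw θ μ P)
    (hpos : ∀ u v, 0 ≤ barTrans θ u v)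
    (g : State p → State p → ℝ) (hg : ∀ u, ∑ v, barTrans θ u v * g u v = 0)
    (n : ℕ) (S : (Fin (n + 1) → State p) → ℝ) :
    ∫ ω, S (fun i => ω i) * g (ω n) (ω (n + 1)) ∂P = 0 := by
  let φ : (ℕ → State p) → (Fin (n + 1) → State p) × State p := fun ω => (fun i => ω i, ω (n + 1))
  have hφ : Measurable φ := by fun_prop
  let F : (Fin (n + 1) → State p) × State p → ℝ := fun z => S z.1 * g (z.1 (Fin.last n)) z.2
  have hF : ∫ ω, S (fun i => ω i) * g (ω n) (ω (n + 1)) ∂P = ∫ z, F z ∂(P.map φ) := by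
    rw [integral_map hφ.aemeasurable (Measurable.of_discrete).aestronglyMeasurable]
    rfl
  have hPφ : IsProbabilityMeasure (P.map φ) := Measure.isProbabilityMeasure_map hφ.aemeasurable
  have hmass : ∀ y v, (P.map φ).real {(y, v)} =
      P.real {ω | (fun i : Fin (n + 1) => ω i) = y} * barTrans θ (y (Fin.last n)) v := by
    intro y v
    let x : ℕ → State p := fun k => if h : k < n + 1 then y ⟨k, h⟩ else v
    have hx : ∀ k (h : k < n + 1), x k = y ⟨k, h⟩ := fun k h => dif_pos h
    have hxn : x (n + 1) = v := by simp [x]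
    have hxl : x n = y (Fin.last n) := hx n (Nat.lt_succ_self n)
    have hpre : ∀ ω : ℕ → State p,
        (fun i : Fin (n + 1) => ω i) = y ↔ ∀ k ≤ n, ω k = x k := by
      intro ω
      constructor
      · rintro h k hk
        rw [hx k (by omega), ← h]
      · intro h
        funext i
        rw [h i (by omega), hx i i.2]
    have e1 : {ω : ℕ → State p | (fun i : Fin (n + 1) => ω i) = y} =
        {ω | ∀ k ≤ n, ω k = x k} := Set.ext hpre
    have e2 : φ ⁻¹' {(y, v)} = {ω | ∀ k ≤ n + 1, ω k = x k} := by
      ext ω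
      simp only [φ, Set.mem_preimage, Set.mem_singleton_iff, Prod.mk.injEq, Set.mem_ofPred_eq]
      rw [hpre, ← hxn]
      constructor
      · rintro ⟨h1, h2⟩ k hk
        rcases Nat.lt_or_eq_of_le hk with h | rfl
        · exact h1 k (by omega)
        · exact h2
      · exact fun h => ⟨fun k hk => h k (by omega), h _ le_rfl⟩
    rw [map_measureReal_apply hφ (measurableSet_singleton _), e1, e2, measureReal_def,
      measureReal_def, hP, hP, Finset.prod_range_succ, ← mul_assoc,
      ENNReal.ofReal_mul' (hpos _ _), ENNReal.toReal_mul, ENNReal.toReal_ofReal (hpos _ _),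
      hxn, hxl]
  rw [hF, integral_fintype (Integrable.of_finite), Fintype.sum_prod_type]
  refine Finset.sum_eq_zero fun y _ => ?_
  have : ∀ v, (P.map φ).real {(y, v)} • F (y, v) =
      P.real {ω | (fun i : Fin (n + 1) => ω i) = y} * S y *
        (barTrans θ (y (Fin.last n)) v * g (y (Fin.last n)) v) := fun v => by
    rw [hmass, smul_eq_mul]
    ring
  simp_rw [this]
  rw [← Finset.mul_sum, hg, mul_zero]

theorem ae_tendsto_transition_average {p : ℕ} {θ : Param p} {μ : State p → ℝ}
    {P : Measure (ℕ → State p)} [IsProbabilityMeasure P] (hP : IsBARLaw θ μ P)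
    (hpos : ∀ u v, 0 ≤ barTrans θ u v)
    (g : State p → State p → ℝ) (hg : ∀ u, ∑ v, barTrans θ u v * g u v = 0) :
    ∀ᵐ ω ∂P, Tendsto (fun n : ℕ => (∑ k ∈ Finset.range n, g (ω k) (ω (k + 1))) / n)
      atTop (nhds 0) := by
  refine ae_tendsto_sum_div_of_bounded_of_orthogonal P (fun k ω => g (ω k) (ω (k + 1)))
    (∑ u, ∑ v, |g u v|) (fun k => ?_) (fun k ω => ?_) (fun n => ?_)
  · have hg' : Measurable fun z : State p × State p => g z.1 z.2 := Measurable.of_discrete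
    have hpair : Measurable fun ω : ℕ → State p => (ω k, ω (k + 1)) := by fun_prop
    exact hg'.comp hpair
  · refine (Finset.single_le_sum (f := fun v => |g (ω k) v|) (fun v _ => abs_nonneg _)
      (Finset.mem_univ (ω (k + 1)))).trans ?_
    exact Finset.single_le_sum (f := fun u => ∑ v, |g u v|)
      (fun u _ => Finset.sum_nonneg fun v _ => abs_nonneg _) (Finset.mem_univ (ω k))
  · rw [← integral_mul_transition_eq_zero hP hpos g hg n fun y =>
      ∑ k : Fin n, g (y k.castSucc) (y k.succ)]
    refine integral_congr_ae (Eventually.of_forall fun ω => ?_)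
    simp [Finset.sum_range]

/-- Every state is almost surely visited with positive lower frequency. -/
theorem ae_exists_eventually_le_Ncnt {p : ℕ} {θ : Param p} {μ : State p → ℝ}
    {P : Measure (ℕ → State p)} [IsProbabilityMeasure P] (hP : IsBARLaw θ μ P)
    (hpos : ∀ u v, 0 < barTrans θ u v) (v : State p) :
    ∀ᵐ ω ∂P, ∃ δ > 0, ∀ᶠ T : ℕ in atTop, δ * T ≤ (Ncnt v T ω : ℝ) := by
  obtain ⟨u₀, hu₀⟩ := Finite.exists_min fun u => barTrans θ u v
  have hδ := hpos u₀ v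
  set δ := barTrans θ u₀ v
  filter_upwards [ae_tendsto_transition_average hP (fun u v => (hpos u v).le)
    (fun a b => (if b = v then 1 else 0) - barTrans θ a v) fun u => by
      simp [mul_sub, ← Finset.sum_mul, sum_barTrans]] with ω hω
  refine ⟨δ / 4, by positivity, ?_⟩
  have hlow := hω.eventually (lt_mem_nhds (show -(δ / 2) < 0 by linarith))
  obtain ⟨N, hN⟩ := exists_nat_ge (4 / δ)
  filter_upwards [hlow, eventually_ge_atTop N, eventually_ge_atTop 1] with T hT hTN hT1
  have hT0 : (0 : ℝ) < T := by exact_mod_cast hT1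
  rw [lt_div_iff₀ hT0, Finset.sum_sub_distrib] at hT
  have h1 : (T : ℝ) * δ ≤ ∑ k ∈ Finset.range T, barTrans θ (ω k) v := by
    have := Finset.card_nsmul_le_sum (Finset.range T) (fun k => barTrans θ (ω k) v) δ
      fun k _ => hu₀ (ω k)
    simpa using this
  have h2 : ∑ k ∈ Finset.range T, (if ω (k + 1) = v then (1 : ℝ) else 0) ≤ Ncnt v T ω + 1 := by
    have hN : (Ncnt v T ω : ℝ) = ∑ k ∈ Finset.range T, if ω k = v then (1 : ℝ) else 0 := by
      simp [Ncnt]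
    have hs := Finset.sum_range_succ (fun k => if ω k = v then (1 : ℝ) else 0) T
    rw [Finset.sum_range_succ'] at hs
    have hT1 : (if ω T = v then (1 : ℝ) else 0) ≤ 1 := by split_ifs <;> norm_num
    have h01 : (0 : ℝ) ≤ if ω 0 = v then (1 : ℝ) else 0 := by split_ifs <;> norm_num
    rw [hN]
    linarith
  have h3 : 4 / δ ≤ T := hN.trans (by exact_mod_cast hTN)
  rw [div_le_iff₀ hδ] at h3
  nlinarith

theorem ae_tendsto_Nr1_div_Ncnt {p : ℕ} {θ : Param p} {μ : State p → ℝ}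
    {P : Measure (ℕ → State p)} [IsProbabilityMeasure P] (hP : IsBARLaw θ μ P)
    (hpos : ∀ u v, 0 < barTrans θ u v) (u : State p) (r : Fin p) :
    ∀ᵐ ω ∂P, Tendsto (fun T => (Nr1 u r T ω : ℝ) / (Ncnt u T ω : ℝ)) atTop
      (nhds (bern θ u r)) := by
  filter_upwards [ae_exists_eventually_le_Ncnt hP hpos u,
    ae_tendsto_transition_average hP (fun u v => (hpos u v).le)
    (fun a b => if a = u then (if b r then 1 else 0) - bern θ u r else 0) fun a => by
      by_cases h : a = u
      · subst h
        simp only [if_true, mul_sub, Finset.sum_sub_distrib, sum_barTrans_mul_indicator,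
          ← Finset.sum_mul, sum_barTrans]
        ring
      · simp [h]] with ω ⟨δ, hδ, hcount⟩ hω
  rw [tendsto_iff_norm_sub_tendsto_zero]
  have hbound := hω.norm.mul_const δ⁻¹
  rw [norm_zero, zero_mul] at hbound
  refine squeeze_zero' (Eventually.of_forall fun T => norm_nonneg _) ?_ hbound
  filter_upwards [hcount, eventually_ge_atTop 1] with T hT hT1
  have hT0 : (0 : ℝ) < T := by exact_mod_cast hT1
  have hN : (0 : ℝ) < Ncnt u T ω := (mul_pos hδ hT0).trans_le hT
  have hsum : ∑ k ∈ Finset.range T,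
      (if ω k = u then (if ω (k + 1) r then 1 else 0) - bern θ u r else 0) =
      (Nr1 u r T ω : ℝ) - bern θ u r * Ncnt u T ω := by
    rw [← Finset.sum_filter, Finset.sum_sub_distrib, ← Finset.sum_filter, Finset.filter_filter]
    simp [Nr1, Ncnt, mul_comm]
  rw [hsum, div_sub' hN.ne', norm_div, norm_div, Real.norm_of_nonneg hN.le,
    Real.norm_of_nonneg hT0.le, mul_comm (Ncnt u T ω : ℝ), ← div_eq_mul_inv, div_div]
  rw [mul_comm] at hT
  gcongr

theorem isUnit_sum_vecMulVec_stR (p : ℕ) :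
    IsUnit (∑ u : State p, vecMulVec (stR u) (stR u)) := by
  rw [← Matrix.mulVec_injective_iff_isUnit]
  refine (injective_iff_map_eq_zero
    (Matrix.mulVecLin (∑ u : State p, vecMulVec (stR u) (stR u)))).mpr fun x hx => ?_
  have hquad : ∑ u : State p, (stR u ⬝ᵥ x) ^ 2 = 0 := by
    have h : x ⬝ᵥ ((∑ u : State p, vecMulVec (stR u) (stR u)) *ᵥ x) = 0 := by
      rw [Matrix.mulVecLin_apply] at hx
      rw [hx, dotProduct_zero]
    rw [Matrix.sum_mulVec, dotProduct_sum] at h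
    rw [← h]
    refine Finset.sum_congr rfl fun u _ => ?_
    rw [vecMulVec_mulVec, dotProduct_comm x]
    simp [smul_dotProduct, pow_two]
  rw [Finset.sum_eq_zero_iff_of_nonneg fun u _ => sq_nonneg _] at hquad
  funext i
  have hi := hquad (fun j => decide (j = i)) (Finset.mem_univ _)
  simpa [stR, dotProduct] using hi

/-- **Strong consistency of the closed-form estimator for the BAR model with positive
correlations.** Almost surely under `P_{θ0,μ}`: the estimators `ĉ(T)` and `â_r(T)` are
well-defined for all sufficiently large `T` (the zero state has been visited and the Gram
matrix of visited states is invertible), `ĉ(T) → c` where `c_i = b_i ρ_{w_i}`, and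
`â_r(T) → a_r` (the `r`-th row of `A`) for every `r`. -/
theorem closed_form_strong_consistency
    (p : ℕ) (hp : 1 ≤ p) (bmin ρmin ρmax : ℝ)
    (hbmin : bmin ∈ Set.Ioo (0 : ℝ) 1)
    (hρmin : 0 < ρmin) (hρ : ρmin ≤ ρmax) (hρmax : ρmax < 1)
    (θ0 : Param p) (hθ0 : θ0 ∈ barSpace p bmin ρmin ρmax)
    (μ : State p → ℝ) (hμ0 : ∀ u, 0 ≤ μ u) (hμ1 : ∑ u, μ u = 1)
    (P : Measure (ℕ → State p)) (hPprob : IsProbabilityMeasure P)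
    (hPlaw : IsBARLaw θ0 μ P) :
    ∀ᵐ ω ∂P,
      (∃ T0, ∀ T ≥ T0, 1 ≤ Ncnt (fun _ => false) T ω ∧ IsUnit (gram T ω)) ∧
      Tendsto (fun T => fun i => chat i T ω) atTop
        (nhds (fun i => θ0.2.1 i * θ0.2.2 i)) ∧
      ∀ r : Fin p, Tendsto (fun T => ahat r T ω) atTop (nhds (fun j => θ0.1 r j)) := by
  obtain ⟨hbmin0, -⟩ := hbmin
  have hpos := barTrans_pos hbmin0 hρmin hρmax hθ0
  filter_upwards [ae_all_iff.mpr fun u => ae_exists_eventually_le_Ncnt hPlaw hpos u,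
    ae_all_iff.mpr fun u => ae_all_iff.mpr fun r => ae_tendsto_Nr1_div_Ncnt hPlaw hpos u r]
    with ω hcount hratio
  have hvisit : ∀ᶠ T in atTop, ∀ u, 1 ≤ Ncnt u T ω := by
    refine eventually_all.mpr fun u => ?_
    obtain ⟨δ, hδ, h⟩ := hcount u
    filter_upwards [h, eventually_ge_atTop 1] with T hT hT1
    have hT0 : (0 : ℝ) < T := by exact_mod_cast hT1
    have : (0 : ℝ) < Ncnt u T ω := (mul_pos hδ hT0).trans_le hT
    exact_mod_cast this
  have huniv : ∀ᶠ T in atTop, visited T ω = Finset.univ := by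
    filter_upwards [hvisit] with T hT
    refine Finset.eq_univ_iff_forall.mpr fun u => ?_
    obtain ⟨k, hk⟩ := Finset.card_pos.mp (hT u)
    rw [Finset.mem_filter] at hk
    exact Finset.mem_image.mpr ⟨k, hk.1, hk.2⟩
  have hzero : ∀ i, bern θ0 (fun _ => false) i = θ0.2.1 i * θ0.2.2 i := fun i => by
    simp [bern, stR]
  have hchat : ∀ i, Tendsto (fun T => chat i T ω) atTop (nhds (θ0.2.1 i * θ0.2.2 i)) :=
    fun i => hzero i ▸ hratio (fun _ => false) i
  have hunit := isUnit_sum_vecMulVec_stR p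
  refine ⟨?_, tendsto_pi_nhds.mpr hchat, fun r => ?_⟩
  · rw [← eventually_atTop]
    filter_upwards [hvisit, huniv] with T h1 h2
    refine ⟨h1 _, ?_⟩
    rw [_root_.gram, h2]
    exact hunit
  · set G : Matrix (Fin p) (Fin p) ℝ := ∑ u : State p, vecMulVec (stR u) (stR u) with hG
    have hrhs : Tendsto (fun T => ∑ u : State p,
        (((Nr1 u r T ω : ℝ) / (Ncnt u T ω : ℝ)) - chat r T ω) • stR u) atTop
        (nhds (∑ u : State p, (bern θ0 u r - θ0.2.1 r * θ0.2.2 r) • stR u)) :=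
      tendsto_finsetSum _ fun u _ => ((hratio u r).sub (hchat r)).smul_const _
    have hGa : ∑ u : State p, (bern θ0 u r - θ0.2.1 r * θ0.2.2 r) • stR u =
        G *ᵥ (fun j => θ0.1 r j) := by
      rw [hG, Matrix.sum_mulVec]
      refine Finset.sum_congr rfl fun u _ => ?_
      rw [vecMulVec_mulVec, dotProduct_comm]
      simp only [bern, add_sub_cancel_right, op_smul_eq_smul]
      rfl
    have hcont : Continuous fun x : Fin p → ℝ => G⁻¹ *ᵥ x := by fun_prop
    have hlim := (hcont.tendsto _).comp hrhs
    rw [hGa, Matrix.mulVec_mulVec, Matrix.nonsing_inv_mul _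
      ((Matrix.isUnit_iff_isUnit_det _).mp hunit), Matrix.one_mulVec] at hlim
    refine hlim.congr' ?_
    filter_upwards [huniv] with T hT
    simp [ahat, _root_.gram, hT, hG]
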